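/- Let R be a right noetherian ring and let T be a tilting module in Mod R. Then Findim(R) ≤ pd T + id T, where pd T and id T are the projective and injective dimensions of T. -/

import Mathlib

noncomputable section

open CategoryTheory CategoryTheory.Limits Opposite DirectSum

universe u

namespace CotorsionDim

variable {R : Type u} [Ring R]

/-- `Ext^n_R(M,N) = 0`. -/
def ExtZero (M N : ModuleCat.{u} R) (n : ℕ) : Prop :=
  IsZero (((Ext ℤ (ModuleCat.{u} R) n).obj (op M)).obj N)

/-- A pair of composable maps forms a short exact sequence `0 → A → B → C → 0`. -/
def IsSES {A B C : ModuleCat.{u} R} (f : A ⟶ B) (g : B ⟶ C) : Prop :=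
  ∃ w : f ≫ g = 0, (CategoryTheory.ShortComplex.mk f g w).ShortExact

/-- relative projective dimension `pd_𝒳(M)` -/
def rpd (𝒳 : Set (ModuleCat.{u} R)) (M : ModuleCat.{u} R) : ℕ∞ :=
  sInf {n : ℕ∞ | ∀ j : ℕ, n < (j : ℕ∞) → ∀ X ∈ 𝒳, ExtZero M X j}

/-- relative injective dimension `id_𝒳(M)` -/
def rid (𝒳 : Set (ModuleCat.{u} R)) (M : ModuleCat.{u} R) : ℕ∞ :=
  sInf {n : ℕ∞ | ∀ j : ℕ, n < (j : ℕ∞) → ∀ X ∈ 𝒳, ExtZero X M j}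

/-- `pd_𝒳(𝒴)` -/
def rpdClass (𝒳 𝒴 : Set (ModuleCat.{u} R)) : ℕ∞ := ⨆ Y : 𝒴, rpd 𝒳 Y

/-- `id_𝒳(𝒴)` -/
def ridClass (𝒳 𝒴 : Set (ModuleCat.{u} R)) : ℕ∞ := ⨆ Y : 𝒴, rid 𝒳 Y

/-- projective dimension -/
def pd (M : ModuleCat.{u} R) : ℕ∞ := rpd Set.univ M

/-- injective dimension -/
def idim (M : ModuleCat.{u} R) : ℕ∞ := rid Set.univ M

/-- `pd(𝒴)` -/
def pdClass (𝒴 : Set (ModuleCat.{u} R)) : ℕ∞ := ⨆ Y : 𝒴, pd Y.1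

/-- `id(𝒴)` -/
def idClass (𝒴 : Set (ModuleCat.{u} R)) : ℕ∞ := ⨆ Y : 𝒴, idim Y.1

/-- `M` has an `𝒳`-resolution `0 → X_n → ⋯ → X_0 → M → 0` of length `n`. -/
def HasResLen (𝒳 : Set (ModuleCat.{u} R)) : ℕ → ModuleCat.{u} R → Prop
  | 0, M => M ∈ 𝒳
  | n+1, M => ∃ (K X : ModuleCat.{u} R) (f : K ⟶ X) (g : X ⟶ M),
      X ∈ 𝒳 ∧ IsSES f g ∧ HasResLen 𝒳 n K

/-- `M` has an `𝒳`-coresolution `0 → M → X_0 → ⋯ → X_n → 0` of length `n`. -/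
def HasCoresLen (𝒳 : Set (ModuleCat.{u} R)) : ℕ → ModuleCat.{u} R → Prop
  | 0, M => M ∈ 𝒳
  | n+1, M => ∃ (X C : ModuleCat.{u} R) (f : M ⟶ X) (g : X ⟶ C),
      X ∈ 𝒳 ∧ IsSES f g ∧ HasCoresLen 𝒳 n C

/-- `resdim_𝒳(M)` -/
def resdim (𝒳 : Set (ModuleCat.{u} R)) (M : ModuleCat.{u} R) : ℕ∞ :=
  ⨅ n : {n : ℕ // HasResLen 𝒳 n M}, (n : ℕ∞)

/-- `coresdim_𝒳(M)` -/
def coresdim (𝒳 : Set (ModuleCat.{u} R)) (M : ModuleCat.{u} R) : ℕ∞ :=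
  ⨅ n : {n : ℕ // HasCoresLen 𝒳 n M}, (n : ℕ∞)

/-- `resdim_𝒳(𝒴)` -/
def resdimClass (𝒳 𝒴 : Set (ModuleCat.{u} R)) : ℕ∞ := ⨆ Y : 𝒴, resdim 𝒳 Y

/-- `coresdim_𝒳(𝒴)` -/
def coresdimClass (𝒳 𝒴 : Set (ModuleCat.{u} R)) : ℕ∞ := ⨆ Y : 𝒴, coresdim 𝒳 Y

/-- `𝒳^∧`, the class of modules with a finite `𝒳`-resolution. -/
def resClosure (𝒳 : Set (ModuleCat.{u} R)) : Set (ModuleCat.{u} R) :=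
  {M | ∃ n, HasResLen 𝒳 n M}

/-- `𝒳^∨`, the class of modules with a finite `𝒳`-coresolution. -/
def coresClosure (𝒳 : Set (ModuleCat.{u} R)) : Set (ModuleCat.{u} R) :=
  {M | ∃ n, HasCoresLen 𝒳 n M}

/-- `(𝒜, ℬ)` is a cotorsion pair. -/
def IsCotorsionPair (𝒜 ℬ : Set (ModuleCat.{u} R)) : Prop :=
  (∀ M, M ∈ 𝒜 ↔ ∀ B ∈ ℬ, ExtZero M B 1) ∧
  (∀ M, M ∈ ℬ ↔ ∀ A ∈ 𝒜, ExtZero A M 1)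

/-- completeness of a cotorsion pair -/
def IsComplete (𝒜 ℬ : Set (ModuleCat.{u} R)) : Prop :=
  ∀ M : ModuleCat.{u} R,
    (∃ (B A : ModuleCat.{u} R) (f : B ⟶ A) (g : A ⟶ M), B ∈ ℬ ∧ A ∈ 𝒜 ∧ IsSES f g) ∧
    (∃ (B A : ModuleCat.{u} R) (f : M ⟶ B) (g : B ⟶ A), B ∈ ℬ ∧ A ∈ 𝒜 ∧ IsSES f g)

/-- heredity of a cotorsion pair -/
def IsHereditary (𝒜 ℬ : Set (ModuleCat.{u} R)) : Prop :=
  ∀ i : ℕ, 1 ≤ i → ∀ A ∈ 𝒜, ∀ B ∈ ℬ, ExtZero A B i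

variable (R)

/-- `𝒫`, the class of modules of finite projective dimension. -/
def P : Set (ModuleCat.{u} R) := {M | pd M < ⊤}

variable {R}

/-- `M` admits a projective resolution consisting of finitely generated projectives,
i.e. `M ∈ mod R`. -/
def InmodR (M : ModuleCat.{u} R) : Prop :=
  ∃ K : ℕ → ModuleCat.{u} R, K 0 = M ∧ ∀ i : ℕ,
    ∃ (Q : ModuleCat.{u} R) (f : K (i+1) ⟶ Q) (g : Q ⟶ K i),
      Module.Finite R Q ∧ Projective Q ∧ IsSES f g

variable (R)

/-- `𝒫^{<∞} = 𝒫 ∩ mod R`. -/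
def Pfin : Set (ModuleCat.{u} R) := {M | pd M < ⊤ ∧ InmodR M}

/-- the big finitistic dimension -/
def bigFindim : ℕ∞ := pdClass (P R)

/-- the little finitistic dimension -/
def littleFindim : ℕ∞ := pdClass (Pfin R)

variable {R}

/-- `𝒳^{⊥₁}` -/
def rperp1 (𝒳 : Set (ModuleCat.{u} R)) : Set (ModuleCat.{u} R) :=
  {M | ∀ X ∈ 𝒳, ExtZero X M 1}

/-- `^{⊥₁}𝒳` -/
def lperp1 (𝒳 : Set (ModuleCat.{u} R)) : Set (ModuleCat.{u} R) :=
  {M | ∀ X ∈ 𝒳, ExtZero M X 1}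

/-- `T^⊥ = {M : Ext^i(T,M) = 0 for all i > 0}` -/
def rperpAll (T : ModuleCat.{u} R) : Set (ModuleCat.{u} R) :=
  {M | ∀ i : ℕ, 0 < i → ExtZero T M i}

/-- `Add T`: direct summands of arbitrary direct sums of copies of `T`. -/
def AddT (T : ModuleCat.{u} R) : Set (ModuleCat.{u} R) :=
  {M | ∃ (I : Type u) (s : M ⟶ ModuleCat.of R (I →₀ T)) (r : ModuleCat.of R (I →₀ T) ⟶ M),
    s ≫ r = 𝟙 M}

/-- `T` is a tilting module. -/
def IsTilting (T : ModuleCat.{u} R) : Prop :=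
  pd T < ⊤ ∧
  (∀ i : ℕ, 0 < i → ∀ I : Type u, ExtZero T (ModuleCat.of R (I →₀ T)) i) ∧
  ∃ n, HasCoresLen (AddT T) n (ModuleCat.of R R)


/-- `𝒳` is closed under arbitrary direct sums (coproducts). -/
def ClosedUnderCoproducts (𝒳 : Set (ModuleCat.{u} R)) : Prop :=
  ∀ (I : Type u) (f : I → ModuleCat.{u} R), (∀ i, f i ∈ 𝒳) →
    ModuleCat.of R (⨁ i, (f i : Type u)) ∈ 𝒳

/-- `𝒳` is closed under direct summands. -/
def ClosedUnderSummands (𝒳 : Set (ModuleCat.{u} R)) : Prop :=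
  ∀ (M N : ModuleCat.{u} R) (s : M ⟶ N) (r : N ⟶ M), s ≫ r = 𝟙 M → N ∈ 𝒳 → M ∈ 𝒳

lemma extZero_succ_iff (M N : ModuleCat.{u} R) (k : ℕ) :
    ExtZero M N (k + 1) ↔ Subsingleton (Abelian.Ext.{u} M N (k + 1)) := by
  let Q := projectiveResolution M
  have h₁ : ExtZero M N (k + 1) ↔ ∀ f : Q.complex.X (k + 1) ⟶ N,
      Q.complex.d (k + 2) (k + 1) ≫ f = 0 →
      ∃ g : Q.complex.X k ⟶ N, Q.complex.d (k + 1) k ≫ g = f := by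
    rw [ExtZero, (Q.isoExt (R := ℤ) (k + 1) N).isZero_iff,
      ← HomologicalComplex.exactAt_iff_isZero_homology,
      HomologicalComplex.exactAt_iff' _ k (k + 1) (k + 2) (by simp) (by simp),
      ShortComplex.moduleCat_exact_iff]
    exact Iff.rfl
  rw [h₁]
  refine ⟨fun h ↦ subsingleton_of_forall_eq 0 fun e ↦ ?_, fun h f hf ↦ ?_⟩
  · obtain ⟨f, hf, rfl⟩ := Q.extMk_surjective e (k + 2) rfl
    exact (Q.extMk_eq_zero_iff f _ rfl hf k rfl).2 (h f hf)
  · exact (Q.extMk_eq_zero_iff f _ rfl hf k rfl).1 (Subsingleton.elim _ _)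

lemma extZero_iff {j : ℕ} (hj : 0 < j) (M N : ModuleCat.{u} R) :
    ExtZero M N j ↔ Subsingleton (Abelian.Ext.{u} M N j) := by
  obtain ⟨j, rfl⟩ := Nat.exists_eq_succ_of_ne_zero hj.ne'
  exact extZero_succ_iff M N j

lemma pd_le_iff (M : ModuleCat.{u} R) (n : ℕ) :
    pd M ≤ n ↔ HasProjectiveDimensionLT M (n + 1) := by
  constructor
  · intro h
    have hmem : pd M ∈ {n : ℕ∞ | ∀ j : ℕ, n < (j : ℕ∞) → ∀ X ∈ Set.univ, ExtZero M X j} :=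
      csInf_mem ⟨⊤, by simp⟩
    refine HasProjectiveDimensionLT.mk.{u} fun i hi Y e ↦ ?_
    have := (extZero_iff (by lia) M Y).1
      (hmem i (h.trans_lt (Nat.cast_lt.2 hi)) Y trivial)
    exact Subsingleton.elim _ _
  · intro h
    refine sInf_le fun j hj X _ ↦ ?_
    have hj' : n < j := Nat.cast_lt.1 hj
    exact (extZero_iff (by lia) M X).2 (HasProjectiveDimensionLT.subsingleton M (n + 1) _ hj' X)

lemma idim_le_iff (M : ModuleCat.{u} R) (n : ℕ) :
    idim M ≤ n ↔ HasInjectiveDimensionLT M (n + 1) := by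
  constructor
  · intro h
    have hmem : idim M ∈ {n : ℕ∞ | ∀ j : ℕ, n < (j : ℕ∞) → ∀ X ∈ Set.univ, ExtZero X M j} :=
      csInf_mem ⟨⊤, by simp⟩
    refine HasInjectiveDimensionLT.mk.{u} fun i hi Y e ↦ ?_
    have := (extZero_iff (by lia) Y M).1
      (hmem i (h.trans_lt (Nat.cast_lt.2 hi)) Y trivial)
    exact Subsingleton.elim _ _
  · intro h
    refine sInf_le fun j hj X _ ↦ ?_
    have hj' : n < j := Nat.cast_lt.1 hj
    exact (extZero_iff (by lia) X M).2 (HasInjectiveDimensionLT.subsingleton M (n + 1) _ hj' X)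

lemma ext_subsingleton_X₃ {S : ShortComplex (ModuleCat.{u} R)} (hS : S.ShortExact)
    (A : ModuleCat.{u} R) (j : ℕ) (h₂ : Subsingleton (Abelian.Ext.{u} A S.X₂ j))
    (h₁ : Subsingleton (Abelian.Ext.{u} A S.X₁ (j + 1))) :
    Subsingleton (Abelian.Ext.{u} A S.X₃ j) := by
  refine subsingleton_of_forall_eq 0 fun e ↦ ?_
  obtain ⟨x, rfl⟩ := Abelian.Ext.covariant_sequence_exact₃ _ hS e rfl (Subsingleton.elim _ _)
  rw [Subsingleton.elim x 0, Abelian.Ext.zero_comp]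

lemma ext_subsingleton_X₁_left {S : ShortComplex (ModuleCat.{u} R)} (hS : S.ShortExact)
    (N : ModuleCat.{u} R) (j : ℕ) (h₂ : Subsingleton (Abelian.Ext.{u} S.X₂ N j))
    (h₃ : Subsingleton (Abelian.Ext.{u} S.X₃ N (1 + j))) :
    Subsingleton (Abelian.Ext.{u} S.X₁ N j) := by
  refine subsingleton_of_forall_eq 0 fun e ↦ ?_
  obtain ⟨x, rfl⟩ := Abelian.Ext.contravariant_sequence_exact₁ hS _ e rfl (Subsingleton.elim _ _)
  rw [Subsingleton.elim x 0, Abelian.Ext.comp_zero]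

lemma ext_subsingleton_of_retract_left {A B : ModuleCat.{u} R} (s : A ⟶ B) (r : B ⟶ A)
    (h : s ≫ r = 𝟙 A) (N : ModuleCat.{u} R) (j : ℕ)
    (hB : Subsingleton (Abelian.Ext.{u} B N j)) : Subsingleton (Abelian.Ext.{u} A N j) := by
  refine subsingleton_of_forall_eq 0 fun e ↦ ?_
  rw [← e.mk₀_id_comp, ← h, ← Abelian.Ext.mk₀_comp_mk₀_assoc,
    Subsingleton.elim ((Abelian.Ext.mk₀ r).comp e (zero_add j)) 0, Abelian.Ext.comp_zero]

lemma ext_subsingleton_of_retract_right {A B : ModuleCat.{u} R} (s : A ⟶ B) (r : B ⟶ A)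
    (h : s ≫ r = 𝟙 A) (N : ModuleCat.{u} R) (j : ℕ)
    (hB : Subsingleton (Abelian.Ext.{u} N B j)) : Subsingleton (Abelian.Ext.{u} N A j) := by
  refine subsingleton_of_forall_eq 0 fun e ↦ ?_
  rw [← e.comp_mk₀_id, ← h, ← Abelian.Ext.mk₀_comp_mk₀, ← Abelian.Ext.comp_assoc_of_second_deg_zero,
    Subsingleton.elim (e.comp (Abelian.Ext.mk₀ s) (add_zero j)) 0, Abelian.Ext.zero_comp]

lemma ext_subsingleton_X₁ {S : ShortComplex (ModuleCat.{u} R)} (hS : S.ShortExact)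
    (A : ModuleCat.{u} R) (j : ℕ) (h₃ : Subsingleton (Abelian.Ext.{u} A S.X₃ j))
    (h₂ : Subsingleton (Abelian.Ext.{u} A S.X₂ (j + 1))) :
    Subsingleton (Abelian.Ext.{u} A S.X₁ (j + 1)) := by
  refine subsingleton_of_forall_eq 0 fun e ↦ ?_
  obtain ⟨x, rfl⟩ := Abelian.Ext.covariant_sequence_exact₁ _ hS e (Subsingleton.elim _ _) rfl
  rw [Subsingleton.elim x 0, Abelian.Ext.zero_comp]

/-- `Ext` in positive degrees out of a direct sum of copies of `T` vanishes if it does so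
out of `T`. -/
lemma ext_finsupp_subsingleton (T : ModuleCat.{u} R) (I : Type u) (j : ℕ) :
    ∀ N : ModuleCat.{u} R, Subsingleton (Abelian.Ext.{u} T N (j + 1)) →
      Subsingleton (Abelian.Ext.{u} (ModuleCat.of R (I →₀ T)) N (j + 1)) := by
  induction j with
  | zero =>
    intro N hN
    obtain ⟨J, _, f, _⟩ := EnoughInjectives.presentation N
    have hS : (ShortComplex.mk f (cokernel.π f) (cokernel.condition f)).ShortExact :=
      { exact := ShortComplex.exact_cokernel f }
    refine subsingleton_of_forall_eq 0 fun e ↦ ?_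
    obtain ⟨x, rfl⟩ := Abelian.Ext.covariant_sequence_exact₁ _ hS e
      (Abelian.Ext.eq_zero_of_injective _) rfl
    obtain ⟨φ, rfl⟩ := Abelian.Ext.homEquiv₀.symm.surjective x
    have hlift (i : I) : ∃ ψ : T ⟶ J,
        ψ ≫ cokernel.π f = ModuleCat.ofHom (Finsupp.lsingle i) ≫ φ := by
      obtain ⟨y, hy⟩ := Abelian.Ext.covariant_sequence_exact₃ _ hS
        (Abelian.Ext.mk₀ (ModuleCat.ofHom (Finsupp.lsingle i) ≫ φ)) rfl (Subsingleton.elim _ _)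
      obtain ⟨ψ, rfl⟩ := Abelian.Ext.homEquiv₀.symm.surjective y
      exact ⟨ψ, Abelian.Ext.homEquiv₀.symm.injective (by simpa using hy)⟩
    choose ψ hψ using hlift
    have hφ : ModuleCat.ofHom (Finsupp.lsum ℕ fun i ↦ (ψ i).hom) ≫ cokernel.π f = φ := by
      ext : 1
      refine Finsupp.lhom_ext' fun i ↦ ?_
      have := congr_arg ModuleCat.Hom.hom (hψ i)
      ext x
      simpa using LinearMap.congr_fun this x
    have hδ := hS.comp_extClass
    dsimp only at hδ
    rw [← hφ, Abelian.Ext.homEquiv₀_symm_apply, ← Abelian.Ext.mk₀_comp_mk₀,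
      Abelian.Ext.comp_assoc_of_second_deg_zero, hδ, Abelian.Ext.comp_zero]
  | succ j ih =>
    intro N hN
    obtain ⟨J, _, f, _⟩ := EnoughInjectives.presentation N
    have hS : (ShortComplex.mk f (cokernel.π f) (cokernel.condition f)).ShortExact :=
      { exact := ShortComplex.exact_cokernel f }
    exact ext_subsingleton_X₁ hS _ (j + 1)
      (ih (cokernel f) (ext_subsingleton_X₃ hS T (j + 1)
        (HasInjectiveDimensionLT.subsingleton J 1 _ (by lia) _) hN))
      (HasInjectiveDimensionLT.subsingleton J 1 _ (by lia) _)

lemma baer_finsupp [IsNoetherianRing R] {Q : Type u} [AddCommGroup Q] [Module R Q]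
    (hQ : Module.Baer R Q) (I : Type u) : Module.Baer R (I →₀ Q) := by
  classical
  intro J f
  obtain ⟨S, hS⟩ : (LinearMap.range f).FG := Module.Finite.iff_fg.1 inferInstance
  have hsupp (x : J) : f x ∈ Finsupp.supported Q R (S.biUnion Finsupp.support : Set I) := by
    refine (hS ▸ Submodule.span_le.2 fun y hy ↦ ?_ :
      LinearMap.range f ≤ Finsupp.supported Q R (S.biUnion Finsupp.support : Set I)) ⟨x, rfl⟩
    exact Finset.coe_subset.2 (Finset.subset_biUnion_of_mem Finsupp.support hy)
  choose g hg using fun i : I ↦ hQ J (Finsupp.lapply i ∘ₗ f)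
  refine ⟨∑ i ∈ S.biUnion Finsupp.support, Finsupp.lsingle i ∘ₗ g i, fun x hx ↦ ?_⟩
  have hx' : (f ⟨x, hx⟩).support ⊆ S.biUnion Finsupp.support := Finset.coe_subset.1 (hsupp ⟨x, hx⟩)
  rw [LinearMap.sum_apply]
  refine Eq.trans (Finset.sum_congr rfl fun i _ ↦ ?_)
    ((Finsupp.sum_of_support_subset _ hx' _ (by simp)).symm.trans (Finsupp.sum_single _))
  simp [hg i x hx]

/-- Over a noetherian ring, direct sums do not raise the injective dimension. -/
lemma hasInjectiveDimensionLT_finsupp [IsNoetherianRing R] (I : Type u) (m : ℕ) :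
    ∀ N : ModuleCat.{u} R, HasInjectiveDimensionLT N (m + 1) →
      HasInjectiveDimensionLT (ModuleCat.of R (I →₀ N)) (m + 1) := by
  induction m with
  | zero =>
    intro N hN
    rw [zero_add, ← injective_iff_hasInjectiveDimensionLT_one,
      ← Module.injective_iff_injective_object, ← Module.Baer.iff_injective] at hN ⊢
    exact baer_finsupp hN I
  | succ m ih =>
    intro N hN
    obtain ⟨J, _, f, _⟩ := EnoughInjectives.presentation N
    have hS : (ShortComplex.mk f (cokernel.π f) (cokernel.condition f)).ShortExact :=
      { exact := ShortComplex.exact_cokernel f }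
    have hJ : HasInjectiveDimensionLT (ModuleCat.of R (I →₀ J)) 1 := by
      have : Module.Injective R J := Module.injective_module_of_injective_object R J
      rw [← injective_iff_hasInjectiveDimensionLT_one, ← Module.injective_iff_injective_object,
        ← Module.Baer.iff_injective]
      exact baer_finsupp (Module.Baer.of_injective this) I
    have hC := ih _ ((hS.hasInjectiveDimensionLT_X₃_iff m inferInstance).2 hN)
    let S' : ShortComplex (ModuleCat.{u} R) :=
      ShortComplex.mk (X₁ := ModuleCat.of R (I →₀ N)) (X₂ := ModuleCat.of R (I →₀ J))
        (X₃ := ModuleCat.of R (I →₀ (cokernel f : ModuleCat.{u} R)))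
        (ModuleCat.ofHom (Finsupp.mapRange.linearMap f.hom))
        (ModuleCat.ofHom (Finsupp.mapRange.linearMap (cokernel.π f).hom)) (by
          rw [← ModuleCat.ofHom_comp, ← Finsupp.mapRange.linearMap_comp, ← ModuleCat.hom_comp,
            cokernel.condition]
          ext : 1
          exact Finsupp.lhom_ext fun i x ↦ by simp)
    have hS' : S'.ShortExact := by
      have hf := (ModuleCat.mono_iff_injective f).1 inferInstance
      refine ModuleCat.shortComplex_shortExact S' (fun y ↦ ⟨fun hy ↦ ?_, ?_⟩)
        (Finsupp.mapRange_injective _ (map_zero _) hf)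
        (Finsupp.mapRange_surjective _ (map_zero _)
          ((ModuleCat.epi_iff_surjective (cokernel.π f)).1 inferInstance))
      · have hinv := Function.leftInverse_invFun hf
        have hzero : Function.invFun f 0 = 0 := by simpa using hinv 0
        refine ⟨Finsupp.mapRange (Function.invFun f) hzero y, Finsupp.ext fun i ↦ ?_⟩
        exact Function.invFun_eq ((ShortComplex.moduleCat_exact_iff _).1 hS.exact _
          (DFunLike.congr_fun hy i))
      · rintro ⟨x, rfl⟩
        exact ConcreteCategory.congr_hom S'.zero x
    exact (hS'.hasInjectiveDimensionLT_X₃_iff m (injective_iff_hasInjectiveDimensionLT_one.2 hJ)).1 hC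

lemma ext_subsingleton_of_hasCoresLen {𝒳 : Set (ModuleCat.{u} R)} {N : ModuleCat.{u} R}
    (hN : ∀ A ∈ 𝒳, ∀ j, 0 < j → Subsingleton (Abelian.Ext.{u} A N j)) (k : ℕ) :
    ∀ C, HasCoresLen 𝒳 k C → ∀ j, 0 < j → Subsingleton (Abelian.Ext.{u} C N j) := by
  induction k with
  | zero => exact hN
  | succ k ih =>
    rintro C ⟨X, C', f, g, hX, ⟨w, hS⟩, hC'⟩ j hj
    exact ext_subsingleton_X₁_left hS N j (hN X hX j hj) (ih C' hC' (1 + j) (by lia))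

/-- A module with a finite coresolution by a self-orthogonal class `𝒳` of modules of injective
dimension at most `m` has injective dimension at most `m + n` if `Ext` from `𝒳` to it vanishes
above degree `n`. -/
lemma hasInjectiveDimensionLT_of_hasCoresLen {𝒳 : Set (ModuleCat.{u} R)} {m : ℕ}
    (hid : ∀ A ∈ 𝒳, HasInjectiveDimensionLT A (m + 1))
    (horth : ∀ A ∈ 𝒳, ∀ B ∈ 𝒳, ∀ j, 0 < j → Subsingleton (Abelian.Ext.{u} A B j)) (k : ℕ) :
    ∀ (n : ℕ) (N : ModuleCat.{u} R), HasCoresLen 𝒳 k N →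
      (∀ A ∈ 𝒳, ∀ j, n < j → Subsingleton (Abelian.Ext.{u} A N j)) →
      HasInjectiveDimensionLT N (m + n + 1) := by
  induction k with
  | zero =>
    intro n N hN _
    have := hid N hN
    exact hasInjectiveDimensionLT_of_ge N (m + 1) _ (by lia)
  | succ k ih =>
    rintro n N ⟨X, C, f, g, hX, ⟨w, hS⟩, hC⟩ hN
    have hXid := hid X hX
    have hC' (A) (hA : A ∈ 𝒳) (j : ℕ) (hj : 0 < j) (hjn : n ≤ j) :
        Subsingleton (Abelian.Ext.{u} A C j) :=
      ext_subsingleton_X₃ hS A j (horth A hA X hX j hj) (hN A hA (j + 1) (by lia))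
    cases n with
    | zero =>
      have hsub := ext_subsingleton_of_hasCoresLen hN k C hC 1 one_pos
      obtain ⟨x, hx⟩ := Abelian.Ext.contravariant_sequence_exact₁ hS _
        (Abelian.Ext.mk₀ (𝟙 N)) rfl (Subsingleton.elim _ _)
      obtain ⟨r, rfl⟩ := Abelian.Ext.homEquiv₀.symm.surjective x
      have hr : f ≫ r = 𝟙 N := Abelian.Ext.homEquiv₀.symm.injective (by simpa using hx)
      exact (Retract.mk f r hr).hasInjectiveDimensionLT _
    | succ n =>
      have := ih n C hC fun A hA j hj ↦ hC' A hA j (by lia) hj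
      exact hS.hasInjectiveDimensionLT_X₁ (m + n + 1) this
        (hasInjectiveDimensionLT_of_ge X (m + 1) _ (by lia))

lemma ext_subsingleton_of_free {M : ModuleCat.{u} R} {d b : ℕ}
    (hM : HasProjectiveDimensionLT M (d + 1))
    (hfree : ∀ (I : Type u) (j : ℕ), b < j →
      Subsingleton (Abelian.Ext.{u} M (ModuleCat.of R (I →₀ R)) j)) (k : ℕ) :
    ∀ (N : ModuleCat.{u} R) (j : ℕ), b < j → d < j + k →
      Subsingleton (Abelian.Ext.{u} M N j) := by
  induction k with
  | zero => exact fun N j _ hj ↦ HasProjectiveDimensionLT.subsingleton M (d + 1) j hj N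
  | succ k ih =>
    intro N j hb hj
    let g : ModuleCat.of R (N →₀ R) ⟶ N := ModuleCat.ofHom (Finsupp.linearCombination R id)
    have : Epi g := (ModuleCat.epi_iff_surjective g).2 (Finsupp.linearCombination_id_surjective R N)
    have hS : (ShortComplex.mk (kernel.ι g) g (kernel.condition g)).ShortExact :=
      { exact := ShortComplex.exact_kernel g }
    exact ext_subsingleton_X₃ hS M j (hfree N j hb) (ih (kernel g) (j + 1) (by lia) (by lia))

/-- Corollary 4.6: `Findim(R) ≤ pd T + id T` for a tilting module `T` over a right
noetherian ring. -/
theorem stmt6 {R : Type u} [Ring R] [IsNoetherianRing R]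
    (T : ModuleCat.{u} R) (hT : IsTilting T) :
    bigFindim R ≤ pd T + idim T := by
  have hfin := hT.1
  obtain ⟨-, hself, k, hR⟩ := hT
  cases hm : idim T using ENat.recTopCoe with
  | top => simp
  | coe m =>
  obtain ⟨n, hn⟩ := ENat.ne_top_iff_exists.1 hfin.ne
  rw [← hn]
  have hid := (idim_le_iff T m).1 hm.le
  have hpd := (pd_le_iff T n).1 hn.ge
  have hself' (I J : Type u) (j : ℕ) (hj : 0 < j) : Subsingleton
      (Abelian.Ext.{u} (ModuleCat.of R (I →₀ T)) (ModuleCat.of R (J →₀ T)) j) := by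
    obtain ⟨j, rfl⟩ := Nat.exists_eq_succ_of_ne_zero hj.ne'
    exact ext_finsupp_subsingleton T I j _ ((extZero_iff hj _ _).1 (hself _ hj J))
  have hRid : HasInjectiveDimensionLT (ModuleCat.of R R) (m + n + 1) := by
    refine hasInjectiveDimensionLT_of_hasCoresLen (𝒳 := AddT T) ?_ ?_ k n _ hR ?_
    · rintro A ⟨I, s, r, h⟩
      have := hasInjectiveDimensionLT_finsupp I m T hid
      exact (Retract.mk s r h).hasInjectiveDimensionLT _
    · rintro A ⟨I, s, r, h⟩ B ⟨J, s', r', h'⟩ j hj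
      exact ext_subsingleton_of_retract_left s r h _ _
        (ext_subsingleton_of_retract_right s' r' h' _ _ (hself' I J j hj))
    · rintro A ⟨I, s, r, h⟩ j hj
      obtain ⟨j, rfl⟩ := Nat.exists_eq_succ_of_ne_zero (Nat.ne_zero_of_lt hj)
      exact ext_subsingleton_of_retract_left s r h _ _
        (ext_finsupp_subsingleton T I j _
          (HasProjectiveDimensionLT.subsingleton T (n + 1) _ hj _))
  refine iSup_le fun ⟨M, hM⟩ ↦ ?_
  obtain ⟨d, hd⟩ := ENat.ne_top_iff_exists.1 (ne_of_lt hM)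
  rw [← Nat.cast_add, pd_le_iff]
  refine HasProjectiveDimensionLT.mk.{u} fun i hi N e ↦ ?_
  have := ext_subsingleton_of_free ((pd_le_iff M d).1 hd.ge) (b := m + n) (fun I j hj ↦ by
    have := hasInjectiveDimensionLT_finsupp I (m + n) _ hRid
    exact HasInjectiveDimensionLT.subsingleton _ (m + n + 1) j hj M) (d + 1) N i (by lia) (by lia)
  exact Subsingleton.elim _ _

end CotorsionDim
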